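/- Let p be a prime and s, n positive integers with s ∣ n. Let u, d be positive integers such that u ≡ p^{j₀} (mod p^s − 1) for some 0 ≤ j₀ ≤ s−1, gcd(u, p^n − 1) = 1, and d·u ≡ 1 (mod p^n − 1). Let ∘ be a presemifield multiplication on L admitting a dual ⋆ that is right K-linear. Let η : L → L satisfy η(0) = 0 and, for every x ∈ L \ {0}, η(x) ≠ 0 and x ⋆ (η(x))⁻¹ = 1. Let α ∈ L with α ≠ 0 and i₀ ∈ K. Define ν : L → L by ν(0) = 0 and ν(x) = (η(x)⁻¹)^u for x ≠ 0, and define M : L × L → K by M(x,y) = Tr^n_s(α·ν(x)·y) + i₀·(1 − x^{p^n − 1}) (this value lies in K). Then M is a vectorial dual-bent function satisfying Condition A with ε = 1: there exists M* : L × L → K such that for every c ∈ K \ {0} and every (w,v) ∈ L × L, W_{M_c}(w,v) = p^n·ζ_p^{Tr^s_1(c·M*(w,v))}. -/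

import Mathlib

open Finset

/-- `ζ_p^t = exp(2πi·t.val/p)` for `t : ZMod p`. -/
noncomputable def zetaP (p : ℕ) (t : ZMod p) : ℂ :=
  Complex.exp (2 * Real.pi * Complex.I * (t.val : ℂ) / (p : ℂ))

noncomputable instance (p n : ℕ) [Fact p.Prime] : Fintype (GaloisField p n) :=
  Fintype.ofFinite _

/-- The absolute trace of `GaloisField p n` down to `ZMod p`. -/
noncomputable def absTr (p n : ℕ) [Fact p.Prime] (x : GaloisField p n) : ZMod p :=
  Algebra.trace (ZMod p) (GaloisField p n) x

/-- The relative trace to the `p^s`-element subfield of `GaloisField p n`,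
`x ↦ ∑_{j=0}^{n/s−1} x^{(p^s)^j}`, as an element of `GaloisField p n`. -/
noncomputable def relTr (p n s : ℕ) [Fact p.Prime] (x : GaloisField p n) : GaloisField p n :=
  ∑ j ∈ Finset.range (n / s), x ^ (p ^ s) ^ j

theorem zetaP_eq_stdAddChar (p : ℕ) [Fact p.Prime] (t : ZMod p) :
    zetaP p t = ZMod.stdAddChar t := by
  rw [ZMod.stdAddChar_apply, ZMod.toCircle_apply, zetaP]

theorem absTr_add (p n : ℕ) [Fact p.Prime] (x y : GaloisField p n) :
    absTr p n (x + y) = absTr p n x + absTr p n y :=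
  map_add _ x y

theorem absTr_sub (p n : ℕ) [Fact p.Prime] (x y : GaloisField p n) :
    absTr p n (x - y) = absTr p n x - absTr p n y :=
  map_sub _ x y

theorem absTr_neg (p n : ℕ) [Fact p.Prime] (x : GaloisField p n) :
    absTr p n (-x) = -absTr p n x :=
  map_neg _ x

theorem absTr_zero (p n : ℕ) [Fact p.Prime] : absTr p n 0 = 0 :=
  map_zero _

theorem exists_absTr_mul_ne_zero (p n : ℕ) [Fact p.Prime] {a : GaloisField p n} (ha : a ≠ 0) :
    ∃ b, absTr p n (a * b) ≠ 0 := by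
  by_contra! h
  exact ha ((traceForm_nondegenerate (ZMod p) (GaloisField p n)).1 a h)

theorem eq_of_absTr_mul_eq (p n : ℕ) [Fact p.Prime] {a b : GaloisField p n}
    (h : ∀ x, absTr p n (x * a) = absTr p n (x * b)) : a = b := by
  by_contra hab
  obtain ⟨x, hx⟩ := exists_absTr_mul_ne_zero p n (sub_ne_zero.2 hab)
  refine hx ?_
  rw [mul_comm, mul_sub, absTr_sub, h x, sub_self]

theorem absTr_pow_prime_pow (p n : ℕ) [Fact p.Prime] (x : GaloisField p n) (j : ℕ) :
    absTr p n (x ^ p ^ j) = absTr p n x := by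
  induction j with
  | zero => simp
  | succ j ih =>
    rw [pow_succ, pow_mul, ← ih]
    have h := Algebra.trace_eq_of_algEquiv
      (FiniteField.frobeniusAlgEquivOfAlgebraic (ZMod p) (GaloisField p n)) (x ^ p ^ j)
    rw [FiniteField.coe_frobeniusAlgEquivOfAlgebraic, ZMod.card] at h
    exact h

theorem sum_zetaP_absTr_mul (p n : ℕ) [Fact p.Prime] (hn : n ≠ 0) (b : GaloisField p n)
    [Decidable (b = 0)] :
    ∑ y : GaloisField p n, zetaP p (absTr p n (b * y)) = if b = 0 then (p : ℂ) ^ n else 0 := by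
  simp only [zetaP_eq_stdAddChar]
  split_ifs with hb
  · subst hb
    simp only [zero_mul, absTr_zero, AddChar.map_zero_eq_one, Finset.sum_const, Finset.card_univ,
      nsmul_eq_mul, mul_one]
    rw [← Nat.card_eq_fintype_card, GaloisField.card p n hn]
    push_cast
    rfl
  · obtain ⟨y, hy⟩ := exists_absTr_mul_ne_zero p n hb
    let ψ : AddChar (GaloisField p n) ℂ :=
      (ZMod.stdAddChar (N := p)).compAddMonoidHom
        ((Algebra.trace (ZMod p) (GaloisField p n)).toAddMonoidHom.comp (AddMonoidHom.mulLeft b))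
    have hψ : ψ ≠ 1 := by
      intro h
      have h1 : ZMod.stdAddChar (absTr p n (b * y)) = 1 := DFunLike.congr_fun h y
      rw [← AddChar.map_zero_eq_one (ZMod.stdAddChar (N := p))] at h1
      exact hy (ZMod.injective_stdAddChar h1)
    exact AddChar.sum_eq_zero_of_ne_one hψ

theorem exists_relTr_preimage (p n s : ℕ) [Fact p.Prime] (hn : n ≠ 0) (hs : s ≠ 0)
    (ι : GaloisField p s →+* GaloisField p n) :
    ∃ T : GaloisField p n → GaloisField p s, ∀ x, ι (T x) = relTr p n s x ∧
      ∀ c, absTr p s (c * T x) = absTr p n (ι c * x) := by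
  let _ : Algebra (GaloisField p s) (GaloisField p n) := ι.toAlgebra
  have : IsScalarTower (ZMod p) (GaloisField p s) (GaloisField p n) :=
    IsScalarTower.of_algebraMap_eq' (Subsingleton.elim _ _)
  refine ⟨Algebra.trace (GaloisField p s) (GaloisField p n), fun x => ⟨?_, fun c => ?_⟩⟩
  · have h := FiniteField.algebraMap_trace_eq_sum_pow (GaloisField p s) (GaloisField p n) x
    have hf := Module.finrank_mul_finrank (ZMod p) (GaloisField p s) (GaloisField p n)
    rw [GaloisField.finrank p hs, GaloisField.finrank p hn] at hf
    rw [GaloisField.card p s hs,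
      ← Nat.div_eq_of_eq_mul_right (Nat.pos_of_ne_zero hs) hf.symm] at h
    exact h
  · have h : c * Algebra.trace (GaloisField p s) (GaloisField p n) x =
        Algebra.trace (GaloisField p s) (GaloisField p n) (ι c * x) := by
      rw [← smul_eq_mul, ← map_smul, Algebra.smul_def]
      rfl
    rw [h]
    exact Algebra.trace_trace _

theorem GaloisField.pow_eq_pow_of_modEq (p n : ℕ) [Fact p.Prime] (hn : n ≠ 0)
    {a : GaloisField p n} (ha : a ≠ 0) {k l : ℕ} (h : k ≡ l [MOD p ^ n - 1]) :
    a ^ k = a ^ l := by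
  have h1 : a ^ (p ^ n - 1) = 1 := by
    rw [← GaloisField.card p n hn, Nat.card_eq_fintype_card]
    exact FiniteField.pow_card_sub_one_eq_one a ha
  have h2 := pow_eq_pow_iff_modEq.2
    (h.of_dvd (orderOf_dvd_of_pow_eq_one (x := Units.mk0 a ha) (Units.ext (by simpa using h1))))
  simpa using congrArg Units.val h2

theorem exists_mul_eq_of_presemifield {F : Type*} [AddGroup F] [Finite F] (mul : F → F → F)
    (hadd : ∀ x y z, mul (x + y) z = mul x z + mul y z)
    (hzero : ∀ x y, mul x y = 0 → x = 0 ∨ y = 0) {y : F} (hy : y ≠ 0) (w : F) :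
    ∃ x, mul x y = w := by
  let f : F →+ F := AddMonoidHom.mk' (fun x => mul x y) fun a b => hadd a b y
  have hf : Function.Injective f :=
    (injective_iff_map_eq_zero f).2 fun x hx => (hzero x y hx).resolve_right hy
  exact Finite.surjective_of_injective hf w

section Dual

variable {p n : ℕ} [Fact p.Prime] {mul str : GaloisField p n → GaloisField p n → GaloisField p n}

theorem dual_add_left
    (hdual : ∀ x y z, absTr p n (z * mul x y) = absTr p n (x * str z y)) (a b y : GaloisField p n) :
    str (a + b) y = str a y + str b y :=
  eq_of_absTr_mul_eq p n fun x => by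
    rw [mul_add, absTr_add, ← hdual, ← hdual, ← hdual, add_mul, absTr_add]

theorem dual_add_right (hadd : ∀ x y z, mul z (x + y) = mul z x + mul z y)
    (hdual : ∀ x y z, absTr p n (z * mul x y) = absTr p n (x * str z y)) (z a b : GaloisField p n) :
    str z (a + b) = str z a + str z b :=
  eq_of_absTr_mul_eq p n fun x => by
    rw [mul_add, absTr_add, ← hdual, ← hdual, ← hdual, hadd, mul_add, absTr_add]

theorem dual_eq_zero (hadd : ∀ x y z, mul (x + y) z = mul x z + mul y z)
    (hzero : ∀ x y, mul x y = 0 → x = 0 ∨ y = 0)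
    (hdual : ∀ x y z, absTr p n (z * mul x y) = absTr p n (x * str z y)) (z y : GaloisField p n)
    (h : str z y = 0) : z = 0 ∨ y = 0 := by
  by_cases hy : y = 0
  · exact Or.inr hy
  · refine Or.inl (eq_of_absTr_mul_eq p n fun w => ?_)
    obtain ⟨x, rfl⟩ := exists_mul_eq_of_presemifield mul hadd hzero hy w
    rw [mul_comm, hdual, h, mul_zero, mul_zero]

theorem dual_left_injective (hadd : ∀ x y z, mul (x + y) z = mul x z + mul y z)
    (hzero : ∀ x y, mul x y = 0 → x = 0 ∨ y = 0)
    (hdual : ∀ x y z, absTr p n (z * mul x y) = absTr p n (x * str z y)) {y : GaloisField p n}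
    (hy : y ≠ 0) : Function.Injective fun z => str z y := by
  let f : GaloisField p n →+ GaloisField p n :=
    AddMonoidHom.mk' (fun z => str z y) fun a b => dual_add_left hdual a b y
  exact (injective_iff_map_eq_zero f).2
    fun z hz => (dual_eq_zero hadd hzero hdual z y hz).resolve_right hy

theorem dual_right_injective (hadd : ∀ x y z, mul (x + y) z = mul x z + mul y z)
    (haddr : ∀ x y z, mul z (x + y) = mul z x + mul z y)
    (hzero : ∀ x y, mul x y = 0 → x = 0 ∨ y = 0)
    (hdual : ∀ x y z, absTr p n (z * mul x y) = absTr p n (x * str z y)) {z : GaloisField p n}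
    (hz : z ≠ 0) : Function.Injective (str z) := by
  let f : GaloisField p n →+ GaloisField p n :=
    AddMonoidHom.mk' (str z) fun a b => dual_add_right haddr hdual z a b
  exact (injective_iff_map_eq_zero f).2
    fun y hy => (dual_eq_zero hadd hzero hdual z y hy).resolve_left hz

end Dual

theorem stmt6 (p : ℕ) [Fact p.Prime] (n s : ℕ) (hn : 0 < n) (hs : 0 < s) (hsn : s ∣ n)
    (u d : ℕ) (hu : 0 < u) (hd : 0 < d)
    (j₀ : ℕ) (hj₀ : j₀ < s) (hmod : u ≡ p ^ j₀ [MOD p ^ s - 1])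
    (hgcd : Nat.gcd u (p ^ n - 1) = 1) (hdu : d * u ≡ 1 [MOD p ^ n - 1])
    -- a presemifield multiplication `∘` on `L = GaloisField p n`
    (mul : GaloisField p n → GaloisField p n → GaloisField p n)
    (hmul_addl : ∀ x y z, mul (x + y) z = mul x z + mul y z)
    (hmul_addr : ∀ x y z, mul z (x + y) = mul z x + mul z y)
    (hmul_zero : ∀ x y, mul x y = 0 → x = 0 ∨ y = 0)
    -- a dual `⋆` of `∘`
    (str : GaloisField p n → GaloisField p n → GaloisField p n)
    (hdual : ∀ x y z, absTr p n (z * mul x y) = absTr p n (x * str z y))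
    -- the subfield `K` with `p^s` elements, realized via a ring embedding
    (ι : GaloisField p s →+* GaloisField p n)
    -- `⋆` is right `K`-linear
    (hlin : ∀ (x y : GaloisField p n) (c : GaloisField p s),
      str x (ι c * y) = ι c * str x y)
    -- `η(0) = 0` and, for `x ≠ 0`, `η(x) ≠ 0` with `x ⋆ η(x)⁻¹ = 1`
    (η : GaloisField p n → GaloisField p n)
    (hη0 : η 0 = 0)
    (hη : ∀ x, x ≠ 0 → η x ≠ 0 ∧ str x (η x)⁻¹ = 1)
    (α : GaloisField p n) (hα : α ≠ 0) (i₀ : GaloisField p s)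
    -- `ν(0) = 0` and `ν(x) = (η(x)⁻¹)^u` for `x ≠ 0`
    (ν : GaloisField p n → GaloisField p n)
    (hν0 : ν 0 = 0)
    (hν : ∀ x, x ≠ 0 → ν x = ((η x)⁻¹) ^ u)
    -- `M(x,y) = Tr^n_s(α·ν(x)·y) + i₀·(1 − x^{p^n−1})`, a `K`-valued function
    (M : GaloisField p n → GaloisField p n → GaloisField p s)
    (hM : ∀ x y, ι (M x y) = relTr p n s (α * ν x * y) + ι i₀ * (1 - x ^ (p ^ n - 1))) :
    -- `M` is vectorial dual-bent satisfying Condition A with `ε = 1`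
    ∃ Md : GaloisField p n → GaloisField p n → GaloisField p s,
      ∀ c : GaloisField p s, c ≠ 0 → ∀ w v : GaloisField p n,
        (∑ x : GaloisField p n, ∑ y : GaloisField p n,
            zetaP p (absTr p s (c * M x y) - absTr p n (w * x + v * y))) =
          (p : ℂ) ^ n * zetaP p (absTr p s (c * Md w v)) := by
  classical
  have hn' : n ≠ 0 := hn.ne'
  have hs' : s ≠ 0 := hs.ne'
  obtain ⟨T, hT⟩ := exists_relTr_preimage p n s hn' hs' ι
  have hM' : ∀ x y, M x y = T (α * ν x * y) + if x = 0 then i₀ else 0 := by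
    intro x y
    apply ι.injective
    rw [hM, map_add, (hT _).1]
    congr 1
    split_ifs with hx
    · have hq : p ^ n - 1 ≠ 0 :=
        (Nat.sub_pos_of_lt (Nat.one_lt_pow hn' (Fact.out : p.Prime).one_lt)).ne'
      rw [hx, zero_pow hq, sub_zero, mul_one]
    · have hx1 := GaloisField.pow_eq_pow_of_modEq p n hn' hx
        (k := p ^ n - 1) (l := 0) (by simp [Nat.ModEq])
      rw [hx1, pow_zero, sub_self, mul_zero, map_zero]
  -- The sum over `y` localizes the Walsh transform at the solutions of `ι c * (α * ν x) = v`.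
  have hinner : ∀ (c : GaloisField p s) (w v x : GaloisField p n),
      ∑ y : GaloisField p n, zetaP p (absTr p s (c * M x y) - absTr p n (w * x + v * y)) =
        if ι c * (α * ν x) = v then
          (p : ℂ) ^ n * zetaP p (absTr p s (c * if x = 0 then i₀ else 0) - absTr p n (w * x))
        else 0 := by
    intro c w v x
    have hterm : ∀ y : GaloisField p n,
        zetaP p (absTr p s (c * M x y) - absTr p n (w * x + v * y)) =
          zetaP p (absTr p n ((ι c * (α * ν x) - v) * y)) *
            zetaP p (absTr p s (c * if x = 0 then i₀ else 0) - absTr p n (w * x)) := by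
      intro y
      simp only [zetaP_eq_stdAddChar]
      rw [← AddChar.map_add_eq_mul, hM', mul_add, absTr_add, (hT _).2, absTr_add, sub_mul,
        absTr_sub, mul_assoc (ι c)]
      congr 1
      ring
    rw [Finset.sum_congr rfl fun y _ => hterm y, ← Finset.sum_mul, sum_zetaP_absTr_mul p n hn']
    simp only [sub_eq_zero, ite_mul, zero_mul]
  have hdu' : ∀ a : GaloisField p n, a ≠ 0 → (a ^ d) ^ u = a := fun a ha => by
    rw [← pow_mul, GaloisField.pow_eq_pow_of_modEq p n hn' ha hdu, pow_one]
  have hud' : ∀ a : GaloisField p n, a ≠ 0 → (a ^ u) ^ d = a := fun a ha => by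
    rw [← pow_mul, mul_comm, pow_mul, hdu' a ha]
  have hνne : ∀ x, x ≠ 0 → ν x ≠ 0 := fun x hx => by
    rw [hν x hx]
    exact pow_ne_zero _ (inv_ne_zero (hη x hx).1)
  have hsol : ∀ c : GaloisField p s, c ≠ 0 → ∀ v x : GaloisField p n, v ≠ 0 →
      (ι c * (α * ν x) = v ↔ str x ((v / α) ^ d) = ι (c ^ d)) := by
    intro c hc v x hv
    have hιc : ι c ≠ 0 := (map_ne_zero ι).2 hc
    have hx0 : ∀ y, str 0 y = 0 := fun y => by
      simpa using dual_add_left hdual 0 0 y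
    constructor
    · intro h
      have hx : x ≠ 0 := by
        rintro rfl
        rw [hν0, mul_zero, mul_zero] at h
        exact hv h.symm
      have hva : v / α = ι c * (η x)⁻¹ ^ u := by
        rw [← h, hν x hx]
        field_simp
      rw [hva, mul_pow, hud' _ (inv_ne_zero (hη x hx).1), ← map_pow, hlin, (hη x hx).2, mul_one]
    · intro h
      have hx : x ≠ 0 := by
        rintro rfl
        rw [hx0] at h
        exact (map_ne_zero ι).2 (pow_ne_zero d hc) h.symm
      have h1 : str x (ι (c ^ d)⁻¹ * (v / α) ^ d) = str x (η x)⁻¹ := by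
        rw [hlin, h, (hη x hx).2, ← map_mul, inv_mul_cancel₀ (pow_ne_zero d hc), map_one]
      have h2 := dual_right_injective hmul_addl hmul_addr hmul_zero hdual hx h1
      rw [hν x hx, ← h2, mul_pow, hdu' _ (div_ne_zero hv hα), map_inv₀, inv_pow, map_pow,
        hdu' _ hιc]
      field_simp
  have hdiv : ∀ v w : GaloisField p n, v ≠ 0 → ∃ a, mul a ((v / α) ^ d) = w := fun v w hv =>
    exists_mul_eq_of_presemifield mul hmul_addl hmul_zero (pow_ne_zero d (div_ne_zero hv hα)) w
  choose! A hA using hdiv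
  refine ⟨fun w v => if v = 0 then i₀ else -T (A v w ^ p ^ j₀), fun c hc w v => ?_⟩
  have hιc : ι c ≠ 0 := (map_ne_zero ι).2 hc
  simp only [hinner]
  by_cases hv : v = 0
  · subst hv
    rw [Finset.sum_eq_single 0]
    · simp [hν0, absTr_zero]
    · intro x _ hx
      rw [if_neg (mul_ne_zero hιc (mul_ne_zero hα (hνne x hx)))]
    · simp
  · have hy : (v / α) ^ d ≠ 0 := pow_ne_zero d (div_ne_zero hv hα)
    have hinj := dual_left_injective hmul_addl hmul_zero hdual hy
    obtain ⟨x₀, hx₀⟩ := Finite.surjective_of_injective hinj (ι (c ^ d))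
    have hx₀ne : x₀ ≠ 0 := by
      rintro rfl
      have := (hsol c hc v 0 hv).2 hx₀
      rw [hν0, mul_zero, mul_zero] at this
      exact hv this.symm
    rw [Finset.sum_eq_single x₀]
    · have hcd : (c ^ d) ^ p ^ j₀ = c := by
        rw [← GaloisField.pow_eq_pow_of_modEq p s hs' (pow_ne_zero d hc) hmod]
        apply ι.injective
        rw [map_pow, map_pow, hdu' _ hιc]
      have htr : absTr p n (w * x₀) = absTr p s (c * T (A v w ^ p ^ j₀)) := by
        rw [(hT _).2, mul_comm w, ← hA v w hv, hdual, hA v w hv]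
        change absTr p n (A v w * (fun z => str z ((v / α) ^ d)) x₀) = _
        rw [hx₀, ← absTr_pow_prime_pow p n _ j₀, mul_pow, ← map_pow, hcd, mul_comm]
      rw [if_pos ((hsol c hc v x₀ hv).2 hx₀), if_neg hx₀ne, if_neg hv, htr, mul_zero, absTr_zero,
        zero_sub, mul_neg, absTr_neg]
    · intro x _ hx
      rw [if_neg fun h => hx (hinj (((hsol c hc v x hv).1 h).trans hx₀.symm))]
    · simp
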